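/- Let k ≥ 1, n = k(k+1)/2, and let λ ⊢ n have column lengths c_1 ≥ c_2 ≥ … ≥ c_l (i.e., c_j = λ'_j and l = λ_1 is the number of columns). If either c_l ≥ k (every column has length at least k) or c_1 ≤ ⌊k/2⌋ + 1 (every column has length at most ⌊k/2⌋ + 1), then λ is dominance-comparable to the staircase ρ_k. -/

import Mathlib

/-- A partition, encoded by its weakly decreasing (0-indexed) sequence of parts,
eventually zero. -/
def IsPtnFun (f : ℕ → ℕ) : Prop :=
  Antitone f ∧ ∃ N, ∀ i, N ≤ i → f i = 0

/-- The size (number of boxes) of a partition: the sum of its parts. -/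
noncomputable def psize (f : ℕ → ℕ) : ℕ := ∑' i, f i

/-- The staircase partition `ρ_m = (m, m-1, …, 1)`. -/
def rho (m : ℕ) : ℕ → ℕ := fun i => m - i

/-- The conjugate partition: `(conjFun f) j = #{i : f i ≥ j + 1}` is the length of
the `(j+1)`-st column of the Young diagram of `f`. -/
noncomputable def conjFun (f : ℕ → ℕ) : ℕ → ℕ := fun j => {i | j + 1 ≤ f i}.ncard

/-- `f` dominates `g`: every partial sum of parts of `f` is at least that of `g`. -/
def Dominates (f g : ℕ → ℕ) : Prop :=
  ∀ r : ℕ, ∑ i ∈ Finset.range r, g i ≤ ∑ i ∈ Finset.range r, f i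

theorem two_mul_sum_rho_add (k r : ℕ) :
    2 * ∑ i ∈ Finset.range r, rho k i + (k - r) * (k - r + 1) = k * (k + 1) := by
  induction r with
  | zero => simp
  | succ r ih =>
    rw [Finset.sum_range_succ, rho, ← ih]
    obtain h | ⟨d, h⟩ : k - r = 0 ∨ ∃ d, k - r = d + 1 := by
      cases k - r <;> simp
    · simp [h, show k - (r + 1) = 0 by omega, rho]
    · rw [h, show k - (r + 1) = d by omega]
      simp only [rho]
      ring

namespace IsPtnFun

variable {f : ℕ → ℕ}

theorem psize_eq_sum_range (hf : IsPtnFun f) {m r : ℕ} (hm : f m = 0) (hmr : m ≤ r) :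
    psize f = ∑ i ∈ Finset.range r, f i := by
  refine tsum_eq_sum fun i hi => ?_
  simp only [Finset.mem_range, not_lt] at hi
  have := hf.1 (hmr.trans hi)
  omega

theorem sum_range_le_psize (hf : IsPtnFun f) (r : ℕ) :
    ∑ i ∈ Finset.range r, f i ≤ psize f := by
  obtain ⟨N, hN⟩ := hf.2
  rw [hf.psize_eq_sum_range (hN N le_rfl) (le_max_left N r)]
  exact Finset.sum_le_sum_of_subset (Finset.range_subset_range.2 (le_max_right N r))

/-- Transposition of the Young diagram: box `(i, j)` lies in it iff row `i` reaches column `j`,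
iff column `j` reaches row `i`. -/
theorem lt_conjFun_iff (hf : IsPtnFun f) (i j : ℕ) : i < conjFun f j ↔ j < f i := by
  obtain ⟨hanti, N, hN⟩ := hf
  constructor
  · intro h
    by_contra! hij
    have hsub : {x | j + 1 ≤ f x} ⊆ (Finset.range i : Set ℕ) := by
      intro x hx
      simp only [Set.mem_ofPred_eq, Finset.coe_range, Set.mem_Iio] at hx ⊢
      by_contra! hix
      have := hanti hix
      omega
    have := Set.ncard_le_ncard hsub (Finset.finite_toSet _)
    rw [Set.ncard_coe_finset, Finset.card_range] at this
    exact absurd h (not_lt.2 this)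
  · intro h
    have hfin : {x | j + 1 ≤ f x}.Finite := by
      refine (Set.finite_lt_nat N).subset fun x hx => ?_
      simp only [Set.mem_ofPred_eq] at hx ⊢
      by_contra! hNx
      have := hN x hNx
      omega
    have hsub : (Finset.range (i + 1) : Set ℕ) ⊆ {x | j + 1 ≤ f x} := by
      intro x hx
      simp only [Set.mem_ofPred_eq, Finset.coe_range, Set.mem_Iio] at hx ⊢
      have := hanti (Nat.le_of_lt_succ hx)
      omega
    have := Set.ncard_le_ncard hsub hfin
    rwa [Set.ncard_coe_finset, Finset.card_range] at this

theorem rho_dominates (hf : IsPtnFun f) {k : ℕ} (hk : 1 ≤ k)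
    (hsize : 2 * psize f = k * (k + 1)) (hcol : ∀ j, j < f 0 → k ≤ conjFun f j) :
    Dominates (rho k) f := by
  have hconst : ∀ i, i < k → f i = f 0 := by
    refine fun i hi => le_antisymm (hf.1 (Nat.zero_le i)) ?_
    by_contra! h
    have := (hf.lt_conjFun_iff i (f i)).1 (hi.trans_le (hcol _ h))
    omega
  have hsum : ∀ r, r ≤ k → ∑ i ∈ Finset.range r, f i = r * f 0 := by
    intro r hr
    rw [Finset.sum_congr rfl fun i hi => hconst i ((Finset.mem_range.1 hi).trans_le hr)]
    simp
  intro r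
  have hrho := two_mul_sum_rho_add k r
  rcases le_total r k with hr | hr
  · have hk0 := hf.sum_range_le_psize k
    rw [hsum k le_rfl] at hk0
    have ha : 2 * f 0 ≤ k + 1 := by
      refine le_of_mul_le_mul_left ?_ (show 0 < k by omega)
      linarith
    rw [hsum r hr]
    obtain ⟨d, rfl⟩ := Nat.exists_eq_add_of_le hr
    rw [Nat.add_sub_cancel_left] at hrho
    nlinarith [Nat.mul_le_mul_left r ha]
  · have := hf.sum_range_le_psize r
    rw [Nat.sub_eq_zero_of_le hr] at hrho
    omega

theorem dominates_rho (hf : IsPtnFun f) {k : ℕ}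
    (hsize : 2 * psize f = k * (k + 1)) (hcol : conjFun f 0 ≤ k / 2 + 1) :
    Dominates f (rho k) := by
  have hm : f (k / 2 + 1) = 0 := by
    by_contra h
    have := (hf.lt_conjFun_iff (k / 2 + 1) 0).2 (Nat.pos_of_ne_zero h)
    omega
  intro r
  induction r with
  | zero => simp
  | succ r ih =>
    have hrho := two_mul_sum_rho_add k (r + 1)
    rcases le_total (k / 2 + 1) (r + 1) with hr | hr
    · have := hf.psize_eq_sum_range hm hr
      omega
    rcases le_or_gt (k - r) (f r) with hfr | hfr
    · rw [Finset.sum_range_succ, Finset.sum_range_succ]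
      exact Nat.add_le_add ih hfr
    · have htail : psize f ≤ ∑ i ∈ Finset.range (r + 1), f i +
          (k / 2 + 1 - (r + 1)) * (k - (r + 1)) := by
        rw [hf.psize_eq_sum_range hm le_rfl, ← Finset.sum_range_add_sum_Ico _ hr]
        gcongr
        rw [← Nat.card_Ico, ← smul_eq_mul]
        refine Finset.sum_le_card_nsmul _ _ _ fun i hi => ?_
        have := hf.1 (show r ≤ i by have := (Finset.mem_Ico.1 hi).1; omega)
        omega
      have hcoef : 2 * (k / 2 + 1 - (r + 1)) ≤ k - (r + 1) + 1 := by omega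
      nlinarith [Nat.mul_le_mul_right (k - (r + 1)) hcoef]

end IsPtnFun

/-- Let `k ≥ 1`, `n = k(k+1)/2` and `λ ⊢ n`.  If every column of `λ` has length at
least `k`, or every column of `λ` has length at most `⌊k/2⌋ + 1`, then `λ` is
dominance-comparable to the staircase `ρ_k`.  (The columns of `λ` are
`conjFun f j` for `j < f 0`, and `f 0 = λ₁` is the number of columns; the longest
column is `conjFun f 0` and the shortest is `conjFun f (f 0 - 1)`.) -/
theorem dominance_from_column_heights (k : ℕ) (hk : 1 ≤ k) (f : ℕ → ℕ)
    (hf : IsPtnFun f) (hsize : psize f = k * (k + 1) / 2)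
    (hcond : (∀ j, j < f 0 → k ≤ conjFun f j) ∨ conjFun f 0 ≤ k / 2 + 1) :
    Dominates f (rho k) ∨ Dominates (rho k) f := by
  have htwo : 2 * psize f = k * (k + 1) := by
    rw [hsize, Nat.two_mul_div_two_of_even (Nat.even_mul_succ_self k)]
  exact hcond.symm.imp (hf.dominates_rho htwo) (hf.rho_dominates hk htwo)
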